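/- arXiv:2006.14548 — 4 statements merged into one kernel-verified Lean document; each statement's English description precedes it below -/
import Mathlib

section
/- Let p ≥ 1 be an integer and C > 0, and let ψ: R → R be a measurable function with |ψ(x)| ≤ C(1 + |x|^p) for all x. For w ∈ R and t > 0 define Ψ(w; t) = E_{z~N(0,1)}[ψ(w + √t · z)]. Then there exists a constant R > 0 depending only on C and p such that for all w, Δw ∈ R, t > 0, and s ≥ 0: |Ψ(w + Δw; t + s) − Ψ(w; t)| ≤ R · (|Δw| + s) · (1 + t^{-1}) · (1 + |w|^p + |Δw|^p + t^{p/2} + s^{p/2}). -/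
set_option autoImplicit false

open MeasureTheory ProbabilityTheory

open scoped NNReal

lemma integrable_sqrt_mul_sqrt {α : Type*} [MeasurableSpace α] {μ : Measure α} {f g : α → ℝ}
    (hf0 : ∀ x, 0 ≤ f x) (hg0 : ∀ x, 0 ≤ g x) (hf : Integrable f μ) (hg : Integrable g μ) :
    Integrable (fun x ↦ √(f x) * √(g x)) μ := by
  refine (hf.add hg).mono' ?_ (ae_of_all _ fun x ↦ ?_)
  · exact (Real.continuous_sqrt.comp_aestronglyMeasurable hf.1).mul
      (Real.continuous_sqrt.comp_aestronglyMeasurable hg.1)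
  · rw [Real.norm_of_nonneg (by positivity), Pi.add_apply]
    nlinarith [Real.sq_sqrt (hf0 x), Real.sq_sqrt (hg0 x), sq_nonneg (√(f x) - √(g x)),
      sq_nonneg (√(f x)), sq_nonneg (√(g x))]

/-- The squared Hellinger distance between two densities, in terms of their affinity. -/
lemma integral_sqrt_sub_sqrt_sq {α : Type*} [MeasurableSpace α] {μ : Measure α} {f g : α → ℝ}
    (hf0 : ∀ x, 0 ≤ f x) (hg0 : ∀ x, 0 ≤ g x) (hf : Integrable f μ) (hg : Integrable g μ) :
    Integrable (fun x ↦ (√(f x) - √(g x)) ^ 2) μ ∧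
      ∫ x, (√(f x) - √(g x)) ^ 2 ∂μ =
        ∫ x, f x ∂μ + ∫ x, g x ∂μ - 2 * ∫ x, √(f x) * √(g x) ∂μ := by
  have hfg := integrable_sqrt_mul_sqrt hf0 hg0 hf hg
  have key : (fun x ↦ (√(f x) - √(g x)) ^ 2) =
      fun x ↦ f x + g x - 2 * (√(f x) * √(g x)) := by
    funext x
    nlinarith [Real.sq_sqrt (hf0 x), Real.sq_sqrt (hg0 x)]
  rw [key]
  refine ⟨(hf.add hg).sub (hfg.const_mul 2), ?_⟩
  rw [← integral_add hf hg, ← integral_const_mul]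
  exact integral_sub (hf.add hg) (hfg.const_mul 2)

/-- Integrals of `ψ` against two densities differ by at most the second moments of `ψ` combined
with the squared Hellinger distance of the densities. -/
lemma abs_integral_mul_sub_integral_mul_le {α : Type*} [MeasurableSpace α] {μ : Measure α}
    {f g ψ : α → ℝ} (hψ : AEStronglyMeasurable ψ μ)
    (hf0 : ∀ x, 0 ≤ f x) (hg0 : ∀ x, 0 ≤ g x) (hf : Integrable f μ) (hg : Integrable g μ)
    (hψf : Integrable (fun x ↦ f x * ψ x ^ 2) μ) (hψg : Integrable (fun x ↦ g x * ψ x ^ 2) μ)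
    {l : ℝ} (hl : 0 < l) :
    |∫ x, f x * ψ x ∂μ - ∫ x, g x * ψ x ∂μ| ≤
      l * (∫ x, f x * ψ x ^ 2 ∂μ + ∫ x, g x * ψ x ^ 2 ∂μ) +
        (2 * l)⁻¹ * ∫ x, (√(f x) - √(g x)) ^ 2 ∂μ := by
  have aux : ∀ {h : α → ℝ}, (∀ x, 0 ≤ h x) → Integrable h μ →
      Integrable (fun x ↦ h x * ψ x ^ 2) μ → Integrable (fun x ↦ h x * ψ x) μ := by
    intro h h0 hh hψh
    refine (hh.add hψh).mono' (hh.1.mul hψ) (ae_of_all _ fun x ↦ ?_)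
    rw [Real.norm_eq_abs, abs_mul, abs_of_nonneg (h0 x), Pi.add_apply]
    nlinarith [h0 x, sq_abs (ψ x), mul_nonneg (h0 x) (sq_nonneg (|ψ x| - 1)),
      mul_nonneg (h0 x) (sq_nonneg (ψ x))]
  have hH := (integral_sqrt_sub_sqrt_sq hf0 hg0 hf hg).1
  have hS : Integrable (fun x ↦ l * (f x * ψ x ^ 2 + g x * ψ x ^ 2)) μ :=
    (hψf.add hψg).const_mul l
  have hH' : Integrable (fun x ↦ (2 * l)⁻¹ * (√(f x) - √(g x)) ^ 2) μ := hH.const_mul _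
  rw [← integral_sub (aux hf0 hf hψf) (aux hg0 hg hψg), ← integral_add hψf hψg,
    ← integral_const_mul, ← integral_const_mul, ← integral_add hS hH', ← Real.norm_eq_abs]
  refine norm_integral_le_of_norm_le (hS.add hH') (ae_of_all _ fun x ↦ ?_)
  have hfx := Real.sq_sqrt (hf0 x)
  have hgx := Real.sq_sqrt (hg0 x)
  set a := √(f x)
  set b := √(g x)
  rw [← hfx, ← hgx, Real.norm_eq_abs]
  have hid : l * (a ^ 2 * ψ x ^ 2 + b ^ 2 * ψ x ^ 2) + (2 * l)⁻¹ * (a - b) ^ 2 =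
      (2 * l)⁻¹ * ((l * ψ x * (a - b)) ^ 2 + (l * ψ x * (a + b)) ^ 2 + (a - b) ^ 2) := by
    field_simp
    ring
  rw [hid, inv_mul_eq_div, le_div_iff₀ (by positivity),
    show a ^ 2 * ψ x - b ^ 2 * ψ x = ψ x * (a + b) * (a - b) by ring, abs_mul]
  have hsq := sq_nonneg (l * |ψ x * (a + b)| - |a - b|)
  rw [sub_sq, mul_pow, sq_abs, sq_abs] at hsq
  linarith [sq_nonneg (l * ψ x * (a - b))]

/-- The affinity of two Gaussian densities. -/
lemma integral_sqrt_gaussianPDFReal_mul_sq (m₁ m₂ : ℝ) {v₁ v₂ : ℝ≥0} (h₁ : v₁ ≠ 0) (h₂ : v₂ ≠ 0) :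
    (∫ x, √(gaussianPDFReal m₁ v₁ x) * √(gaussianPDFReal m₂ v₂ x)) ^ 2 =
      2 * (√v₁ * √v₂) / (v₁ + v₂) * Real.exp (-((m₁ - m₂) ^ 2 / (2 * (v₁ + v₂)))) := by
  have hv₁ : (0 : ℝ) < v₁ := by positivity
  have hv₂ : (0 : ℝ) < v₂ := by positivity
  set c := (m₁ * v₂ + m₂ * v₁) / (v₁ + v₂ : ℝ) with hc
  set b := (v₁ + v₂ : ℝ) / (4 * v₁ * v₂) with hb
  set K := √((√(2 * Real.pi * v₁))⁻¹) * √((√(2 * Real.pi * v₂))⁻¹) *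
    Real.exp (-((m₁ - m₂) ^ 2 / (4 * (v₁ + v₂)))) with hK
  have key : (fun x ↦ √(gaussianPDFReal m₁ v₁ x) * √(gaussianPDFReal m₂ v₂ x)) =
      fun x ↦ K * Real.exp (-b * (x - c) ^ 2) := by
    funext x
    rw [gaussianPDFReal, gaussianPDFReal,
      Real.sqrt_mul (x := (√(2 * Real.pi * v₁))⁻¹) (by positivity),
      Real.sqrt_mul (x := (√(2 * Real.pi * v₂))⁻¹) (by positivity),
      ← Real.exp_half, ← Real.exp_half, mul_mul_mul_comm,
      ← Real.exp_add, hK, mul_assoc _ (Real.exp _), ← Real.exp_add]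
    congr 2
    rw [hb, hc]
    field_simp
    ring
  rw [key, integral_const_mul, integral_sub_right_eq_self (fun x ↦ Real.exp (-b * x ^ 2)),
    integral_gaussian, hK, mul_pow, mul_pow, mul_pow, Real.sq_sqrt (by positivity),
    Real.sq_sqrt (by positivity), Real.sq_sqrt (by positivity), ← Real.exp_nat_mul,
    Real.sqrt_mul (x := 2 * Real.pi) (y := v₁) (by positivity),
    Real.sqrt_mul (x := 2 * Real.pi) (y := v₂) (by positivity), hb]
  have e1 := Real.sq_sqrt hv₁.le
  have e2 := Real.sq_sqrt hv₂.le
  have e3 := Real.sq_sqrt (show 0 ≤ 2 * Real.pi by positivity)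
  have p1 := Real.sqrt_pos.2 hv₁
  have p2 := Real.sqrt_pos.2 hv₂
  have p3 := Real.sqrt_pos.2 (show 0 < 2 * Real.pi by positivity)
  have hexp : ((2 : ℕ) : ℝ) * -((m₁ - m₂) ^ 2 / (4 * (v₁ + v₂))) =
      -((m₁ - m₂) ^ 2 / (2 * (v₁ + v₂))) := by
    push_cast
    field_simp
    ring
  have hcoef : (√(2 * Real.pi) * √v₁)⁻¹ * (√(2 * Real.pi) * √v₂)⁻¹ *
      (Real.pi / ((v₁ + v₂) / (4 * v₁ * v₂))) = 2 * (√v₁ * √v₂) / (v₁ + v₂ : ℝ) := by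
    have : (v₁ + v₂ : ℝ) ≠ 0 := by positivity
    field_simp
    rw [e1, e2, e3]
    ring
  rw [hexp, ← hcoef]
  ring

/-- The squared Hellinger distance of two Gaussian densities. -/
lemma integral_sqrt_gaussianPDFReal_sub_sq_le (m₁ m₂ : ℝ) {v₁ v₂ : ℝ≥0}
    (h₁ : v₁ ≠ 0) (h₂ : v₂ ≠ 0) :
    ∫ x, (√(gaussianPDFReal m₁ v₁ x) - √(gaussianPDFReal m₂ v₂ x)) ^ 2 ≤
      (2 * (√v₁ - √v₂) ^ 2 + (m₁ - m₂) ^ 2) / (v₁ + v₂) := by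
  rw [(integral_sqrt_sub_sqrt_sq (gaussianPDFReal_nonneg m₁ v₁) (gaussianPDFReal_nonneg m₂ v₂)
    (integrable_gaussianPDFReal m₁ v₁) (integrable_gaussianPDFReal m₂ v₂)).2,
    integral_gaussianPDFReal_eq_one _ h₁, integral_gaussianPDFReal_eq_one _ h₂]
  have hA := integral_sqrt_gaussianPDFReal_mul_sq m₁ m₂ h₁ h₂
  set A := ∫ x, √(gaussianPDFReal m₁ v₁ x) * √(gaussianPDFReal m₂ v₂ x)
  have hA0 : 0 ≤ A := integral_nonneg fun x ↦ by positivity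
  have hv₁ : (0 : ℝ) < v₁ := by positivity
  have hv₂ : (0 : ℝ) < v₂ := by positivity
  have e1 := Real.sq_sqrt hv₁.le
  have e2 := Real.sq_sqrt hv₂.le
  set r := 2 * (√v₁ * √v₂) / (v₁ + v₂ : ℝ) with hr
  set d := (m₁ - m₂) ^ 2 / (2 * (v₁ + v₂ : ℝ)) with hd
  have hd0 : 0 ≤ d := by positivity
  have hr0 : 0 ≤ r := by positivity
  have hr1 : r ≤ 1 := by
    rw [hr, div_le_one (by positivity)]
    nlinarith [sq_nonneg (√(v₁ : ℝ) - √v₂)]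
  have hid : (2 * (√v₁ - √v₂) ^ 2 + (m₁ - m₂) ^ 2) / (v₁ + v₂ : ℝ) = 2 * (1 - r + d) := by
    rw [hr, hd]
    field_simp
    linear_combination 2 * e1 + 2 * e2
  rw [hid]
  have hexp : 1 - d ≤ Real.exp (-d) := by linarith [Real.add_one_le_exp (-d)]
  have hexp1 : Real.exp (-d) ≤ 1 := Real.exp_le_one_iff.2 (by linarith)
  have hAsq : A ^ 2 ≤ 1 := hA ▸ mul_le_one₀ hr1 (Real.exp_nonneg _) hexp1
  have hA1 : A ≤ 1 := by nlinarith
  nlinarith [mul_le_mul_of_nonneg_left hexp hr0]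

lemma gaussianReal_map_affine (m : ℝ) {t : ℝ} (ht : 0 ≤ t) :
    (gaussianReal 0 1).map (fun z ↦ m + √t * z) = gaussianReal m t.toNNReal := by
  have h := Measure.map_map (μ := gaussianReal 0 1) (measurable_const_add m)
    (measurable_const_mul √t)
  rw [gaussianReal_map_const_mul, gaussianReal_map_const_add] at h
  rw [show (fun z ↦ m + √t * z) = (m + ·) ∘ (√t * ·) from rfl, ← h]
  congr 1
  · simp
  · ext
    simp [Real.sq_sqrt ht, ht]

lemma integral_gaussianReal_affine {ψ : ℝ → ℝ} (hψ : Measurable ψ) (m : ℝ) {t : ℝ} (ht : 0 < t) :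
    ∫ z, ψ (m + √t * z) ∂(gaussianReal 0 1) =
      ∫ x, gaussianPDFReal m t.toNNReal x * ψ x := by
  rw [← integral_map (φ := fun z ↦ m + √t * z) (f := ψ) (by fun_prop)
    hψ.aestronglyMeasurable, gaussianReal_map_affine m ht.le,
    integral_gaussianReal_eq_integral_smul (by simpa using ht)]
  rfl

lemma integrable_gaussianPDFReal_mul_iff {ψ : ℝ → ℝ} (hψ : Measurable ψ) (m : ℝ) {t : ℝ}
    (ht : 0 < t) :
    Integrable (fun x ↦ gaussianPDFReal m t.toNNReal x * ψ x) ↔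
      Integrable (fun z ↦ ψ (m + √t * z)) (gaussianReal 0 1) := by
  have h := integrable_map_measure (μ := gaussianReal 0 1) (f := fun z ↦ m + √t * z) (g := ψ)
    hψ.aestronglyMeasurable (by fun_prop)
  rw [gaussianReal_map_affine m ht.le, gaussianReal_of_var_ne_zero _ (by simpa using ht),
    integrable_withDensity_iff_integrable_smul' (measurable_gaussianPDF _ _)
      (ae_of_all _ fun _ ↦ gaussianPDF_lt_top)] at h
  simpa [toReal_gaussianPDF, Function.comp_def] using h

/-- The second moment of a polynomially bounded function of a Gaussian variable. -/
lemma integral_sq_gaussianReal_affine_le {p : ℕ} {C : ℝ} {ψ : ℝ → ℝ} (hψ : Measurable ψ)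
    (hC : ∀ x, |ψ x| ≤ C * (1 + |x| ^ p)) (m : ℝ) {σ : ℝ} (hσ : 0 ≤ σ) :
    Integrable (fun z ↦ ψ (m + σ * z) ^ 2) (gaussianReal 0 1) ∧
      ∫ z, ψ (m + σ * z) ^ 2 ∂(gaussianReal 0 1) ≤
        2 * C ^ 2 * (1 + 4 ^ p * ((|m| ^ p) ^ 2 +
          (σ ^ p) ^ 2 * ∫ z, |z| ^ (2 * p) ∂(gaussianReal 0 1))) := by
  have hG : Integrable (fun z : ℝ ↦ |z| ^ (2 * p)) (gaussianReal 0 1) := by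
    simpa using (memLp_id_gaussianReal' (μ := 0) (v := 1) ((2 * p : ℕ) : ENNReal)
      (ENNReal.natCast_ne_top _)).integrable_norm_pow'
  have hB : Integrable (fun z : ℝ ↦ 2 * C ^ 2 * (1 + 4 ^ p * ((|m| ^ p) ^ 2 +
      (σ ^ p) ^ 2 * |z| ^ (2 * p)))) (gaussianReal 0 1) := by
    fun_prop
  have hle : ∀ z, ψ (m + σ * z) ^ 2 ≤ 2 * C ^ 2 * (1 + 4 ^ p * ((|m| ^ p) ^ 2 +
      (σ ^ p) ^ 2 * |z| ^ (2 * p))) := by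
    intro z
    have h1 : ψ (m + σ * z) ^ 2 ≤ (C * (1 + |m + σ * z| ^ p)) ^ 2 := by
      rw [← sq_abs]
      exact pow_le_pow_left₀ (abs_nonneg _) (hC _) 2
    have h2 : |m + σ * z| ^ (2 * p) ≤ 4 ^ p * (|m| ^ (2 * p) + (σ * |z|) ^ (2 * p)) := by
      calc |m + σ * z| ^ (2 * p) ≤ (|m| + σ * |z|) ^ (2 * p) := by
            gcongr
            simpa [abs_mul, abs_of_nonneg hσ] using abs_add_le m (σ * z)
        _ ≤ 2 ^ (2 * p - 1) * (|m| ^ (2 * p) + (σ * |z|) ^ (2 * p)) :=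
            add_pow_le (abs_nonneg _) (by positivity) _
        _ ≤ 2 ^ (2 * p) * (|m| ^ (2 * p) + (σ * |z|) ^ (2 * p)) := by
            gcongr
            · norm_num
            · omega
        _ = _ := by rw [pow_mul]; norm_num
    have h3 : (|m| ^ p) ^ 2 + (σ ^ p) ^ 2 * |z| ^ (2 * p) =
        |m| ^ (2 * p) + (σ * |z|) ^ (2 * p) := by ring
    have h4 : |m + σ * z| ^ (2 * p) = (|m + σ * z| ^ p) ^ 2 := by ring
    rw [h3]
    refine h1.trans ?_
    rw [mul_pow, mul_comm 2 (C ^ 2), mul_assoc]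
    gcongr
    nlinarith [sq_nonneg (|m + σ * z| ^ p - 1)]
  have hI : Integrable (fun z ↦ ψ (m + σ * z) ^ 2) (gaussianReal 0 1) :=
    hB.mono' (Measurable.aestronglyMeasurable (by fun_prop)) (ae_of_all _ fun z ↦ by
      rw [Real.norm_of_nonneg (sq_nonneg _)]
      exact hle z)
  refine ⟨hI, (integral_mono hI hB hle).trans_eq ?_⟩
  rw [integral_const_mul, integral_add (by fun_prop) (by fun_prop), integral_const_mul,
    integral_add (by fun_prop) (by fun_prop), integral_const_mul]
  simp

/-- Gaussian smoothings at two parameters differ by at most their second moments combined with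
the squared Hellinger distance of the Gaussian laws. -/
lemma abs_gaussian_smoothing_sub_le {ψ : ℝ → ℝ} (hψ : Measurable ψ) (m₁ m₂ : ℝ) {t₁ t₂ : ℝ}
    (ht₁ : 0 < t₁) (ht₂ : 0 < t₂)
    (hi₁ : Integrable (fun z ↦ ψ (m₁ + √t₁ * z) ^ 2) (gaussianReal 0 1))
    (hi₂ : Integrable (fun z ↦ ψ (m₂ + √t₂ * z) ^ 2) (gaussianReal 0 1)) {l : ℝ} (hl : 0 < l) :
    |∫ z, ψ (m₁ + √t₁ * z) ∂(gaussianReal 0 1) - ∫ z, ψ (m₂ + √t₂ * z) ∂(gaussianReal 0 1)| ≤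
      l * (∫ z, ψ (m₁ + √t₁ * z) ^ 2 ∂(gaussianReal 0 1) +
          ∫ z, ψ (m₂ + √t₂ * z) ^ 2 ∂(gaussianReal 0 1)) +
        (2 * l)⁻¹ * ((2 * (√t₁ - √t₂) ^ 2 + (m₁ - m₂) ^ 2) / (t₁ + t₂)) := by
  have hψ2 : Measurable fun x ↦ ψ x ^ 2 := hψ.pow_const 2
  rw [integral_gaussianReal_affine hψ m₁ ht₁, integral_gaussianReal_affine hψ m₂ ht₂,
    integral_gaussianReal_affine hψ2 m₁ ht₁, integral_gaussianReal_affine hψ2 m₂ ht₂]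
  refine (abs_integral_mul_sub_integral_mul_le hψ.aestronglyMeasurable
    (gaussianPDFReal_nonneg _ _) (gaussianPDFReal_nonneg _ _)
    (integrable_gaussianPDFReal _ _) (integrable_gaussianPDFReal _ _)
    ((integrable_gaussianPDFReal_mul_iff hψ2 m₁ ht₁).2 hi₁)
    ((integrable_gaussianPDFReal_mul_iff hψ2 m₂ ht₂).2 hi₂) hl).trans ?_
  gcongr
  simpa [ht₁.le, ht₂.le] using integral_sqrt_gaussianPDFReal_sub_sq_le m₁ m₂
    (v₁ := t₁.toNNReal) (v₂ := t₂.toNNReal) (by simpa using ht₁) (by simpa using ht₂)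

/-- The squared Hellinger distance of nearby Gaussian laws is quadratic in the increments. -/
lemma gaussian_hellinger_increment_le (d : ℝ) {t s : ℝ} (ht : 0 < t) (hs : 0 ≤ s) :
    (2 * (√(t + s) - √t) ^ 2 + d ^ 2) / (t + s + t) ≤ 2 * ((|d| + s) * (1 + t⁻¹)) ^ 2 := by
  have hroot : (√(t + s) - √t) ^ 2 ≤ s ^ 2 * t⁻¹ := by
    rw [← div_eq_mul_inv, le_div_iff₀ ht]
    have e1 := Real.sq_sqrt ht.le
    have e2 := Real.sq_sqrt (add_nonneg ht.le hs)
    have p1 := Real.sqrt_nonneg t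
    have p2 := Real.sqrt_nonneg (t + s)
    have hs' : s = (√(t + s) - √t) * (√(t + s) + √t) := by linear_combination e1 - e2
    calc (√(t + s) - √t) ^ 2 * t = (√(t + s) - √t) ^ 2 * √t ^ 2 := by rw [e1]
      _ ≤ (√(t + s) - √t) ^ 2 * (√(t + s) + √t) ^ 2 := by
          gcongr
          linarith
      _ = ((√(t + s) - √t) * (√(t + s) + √t)) ^ 2 := by ring
      _ = s ^ 2 := by rw [← hs']
  calc (2 * (√(t + s) - √t) ^ 2 + d ^ 2) / (t + s + t)
      ≤ (2 * (s ^ 2 * t⁻¹) + d ^ 2) / t := by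
        gcongr
        linarith
    _ = 2 * s ^ 2 * (t⁻¹) ^ 2 + |d| ^ 2 * t⁻¹ := by
        rw [sq_abs]
        field_simp
    _ ≤ 2 * s ^ 2 * (1 + t⁻¹) ^ 2 + |d| ^ 2 * (1 + t⁻¹) ^ 2 := by
        have : 0 < t⁻¹ := inv_pos.2 ht
        gcongr
        · linarith
        · nlinarith
    _ ≤ 2 * ((|d| + s) * (1 + t⁻¹)) ^ 2 := by
        have h : 2 * s ^ 2 + |d| ^ 2 ≤ 2 * (|d| + s) ^ 2 := by
          nlinarith [abs_nonneg d, mul_nonneg (abs_nonneg d) hs, sq_nonneg |d|]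
        nlinarith [mul_le_mul_of_nonneg_right h (sq_nonneg (1 + t⁻¹))]

/-- Squares of `p`-th powers of sums are controlled by the squared polynomial weight. -/
lemma add_pow_sq_le {a b M : ℝ} {p : ℕ} (ha : 0 ≤ a) (hb : 0 ≤ b)
    (hM : (a ^ p) ^ 2 + (b ^ p) ^ 2 ≤ M) : ((a + b) ^ p) ^ 2 ≤ 4 ^ p * M := by
  calc ((a + b) ^ p) ^ 2 = (a + b) ^ (2 * p) := by ring
    _ ≤ 2 ^ (2 * p - 1) * (a ^ (2 * p) + b ^ (2 * p)) := add_pow_le ha hb _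
    _ ≤ 2 ^ (2 * p) * (a ^ (2 * p) + b ^ (2 * p)) := by
        gcongr
        · norm_num
        · omega
    _ = 4 ^ p * ((a ^ p) ^ 2 + (b ^ p) ^ 2) := by
        rw [pow_mul 2]
        norm_num
        ring
    _ ≤ _ := by gcongr

/-- **Smoothness of Gaussian smoothing.** Fix an integer `p ≥ 1` and `C > 0`.  There is a
constant `R > 0`, depending only on `C` and `p`, such that for every measurable `ψ : ℝ → ℝ`
with `|ψ x| ≤ C (1 + |x|^p)`, the smoothing `Ψ (w; t) = E_{z ~ N(0,1)}[ψ (w + √t z)]`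
satisfies, for all `w, Δw ∈ ℝ`, `t > 0`, `s ≥ 0`:
`|Ψ (w + Δw; t + s) − Ψ (w; t)| ≤ R (|Δw| + s)(1 + t⁻¹)(1 + |w|^p + |Δw|^p + t^{p/2} + s^{p/2})`. -/
theorem gaussian_smoothing_smoothness
    (p : ℕ) (hp : 1 ≤ p) (C : ℝ) (hC : 0 < C) :
    ∃ R : ℝ, 0 < R ∧
      ∀ ψ : ℝ → ℝ, Measurable ψ → (∀ x : ℝ, |ψ x| ≤ C * (1 + |x| ^ p)) →
      ∀ (w Δw t s : ℝ), 0 < t → 0 ≤ s →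
        |(∫ z : ℝ, ψ (w + Δw + Real.sqrt (t + s) * z) ∂(gaussianReal 0 1))
            - ∫ z : ℝ, ψ (w + Real.sqrt t * z) ∂(gaussianReal 0 1)|
          ≤ R * (|Δw| + s) * (1 + t⁻¹)
              * (1 + |w| ^ p + |Δw| ^ p + t ^ ((p : ℝ) / 2) + s ^ ((p : ℝ) / 2)) := by
  have hG0 : 0 ≤ ∫ z, |z| ^ (2 * p) ∂(gaussianReal 0 1) := integral_nonneg fun z ↦ by positivity
  set G := ∫ z, |z| ^ (2 * p) ∂(gaussianReal 0 1) with hG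
  set K := 2 * C ^ 2 * (1 + 4 ^ p * (4 ^ p * (1 + G))) with hK
  have hK0 : 0 ≤ K := by positivity
  refine ⟨2 * K + 1, by positivity, fun ψ hψ hψC w Δw t s ht hs ↦ ?_⟩
  have hts : 0 < t + s := by linarith
  rw [Real.rpow_div_two_eq_sqrt _ ht.le, Real.rpow_div_two_eq_sqrt _ hs, Real.rpow_natCast,
    Real.rpow_natCast]
  have hw0 : 0 ≤ |w| ^ p := by positivity
  have hd0 : 0 ≤ |Δw| ^ p := by positivity
  have ht0 : 0 ≤ √t ^ p := by positivity
  have hs0 : 0 ≤ √s ^ p := by positivity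
  set M := 1 + |w| ^ p + |Δw| ^ p + √t ^ p + √s ^ p with hM
  have hM1 : 1 ≤ M := by linarith
  have hMsq : 1 + (|w| ^ p) ^ 2 + (|Δw| ^ p) ^ 2 + (√t ^ p) ^ 2 + (√s ^ p) ^ 2 ≤ M ^ 2 := by
    have h₁ := mul_nonneg hw0 hd0
    have h₂ := mul_nonneg (add_nonneg hw0 hd0) ht0
    have h₃ := mul_nonneg (add_nonneg (add_nonneg hw0 hd0) ht0) hs0
    rw [hM]
    nlinarith
  have hmoment : ∀ {m u : ℝ}, (|m| ^ p) ^ 2 ≤ 4 ^ p * M ^ 2 → (√u ^ p) ^ 2 ≤ 4 ^ p * M ^ 2 →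
      ∫ z, ψ (m + √u * z) ^ 2 ∂(gaussianReal 0 1) ≤ K * M ^ 2 := by
    intro m u hm hu
    calc _ ≤ 2 * C ^ 2 * (1 + 4 ^ p * ((|m| ^ p) ^ 2 + (√u ^ p) ^ 2 * G)) :=
          (integral_sq_gaussianReal_affine_le hψ hψC m (Real.sqrt_nonneg u)).2
      _ ≤ 2 * C ^ 2 * (M ^ 2 + 4 ^ p * (4 ^ p * M ^ 2 + 4 ^ p * M ^ 2 * G)) := by
          gcongr
          nlinarith
      _ = K * M ^ 2 := by
          rw [hK]
          ring
  have hmean : (|w + Δw| ^ p) ^ 2 ≤ 4 ^ p * M ^ 2 := by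
    calc (|w + Δw| ^ p) ^ 2 ≤ ((|w| + |Δw|) ^ p) ^ 2 := by
          gcongr
          exact abs_add_le w Δw
      _ ≤ _ := add_pow_sq_le (abs_nonneg _) (abs_nonneg _) (by nlinarith)
  have hstd : (√(t + s) ^ p) ^ 2 ≤ 4 ^ p * M ^ 2 := by
    calc (√(t + s) ^ p) ^ 2 ≤ ((√t + √s) ^ p) ^ 2 := by
          gcongr
          exact Real.sqrt_le_iff.2 ⟨by positivity, by
            nlinarith [Real.sq_sqrt ht.le, Real.sq_sqrt hs,
              mul_nonneg (Real.sqrt_nonneg t) (Real.sqrt_nonneg s)]⟩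
      _ ≤ _ := add_pow_sq_le (Real.sqrt_nonneg _) (Real.sqrt_nonneg _) (by nlinarith)
  have h4 : M ^ 2 ≤ 4 ^ p * M ^ 2 :=
    le_mul_of_one_le_left (sq_nonneg M) (one_le_pow₀ (by norm_num))
  have hm₁ := hmoment hmean hstd
  have hm₂ := hmoment (m := w) (u := t) (by nlinarith) (by nlinarith)
  rcases (add_nonneg (abs_nonneg Δw) hs).eq_or_lt with h0 | hpos
  · have hΔ : Δw = 0 := abs_eq_zero.1 (by linarith [abs_nonneg Δw])
    have hs' : s = 0 := by linarith [abs_nonneg Δw]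
    simp [hΔ, hs']
  set ε := (|Δw| + s) * (1 + t⁻¹) with hε
  have hε0 : 0 < ε := by positivity
  have hM0 : 0 < M := by linarith
  have hH : (2 * (√(t + s) - √t) ^ 2 + (w + Δw - w) ^ 2) / (t + s + t) ≤ 2 * ε ^ 2 := by
    simpa using gaussian_hellinger_increment_le Δw ht hs
  refine (abs_gaussian_smoothing_sub_le hψ (w + Δw) w hts ht
    (integral_sq_gaussianReal_affine_le hψ hψC _ (Real.sqrt_nonneg _)).1
    (integral_sq_gaussianReal_affine_le hψ hψC _ (Real.sqrt_nonneg _)).1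
    (div_pos hε0 hM0)).trans ?_
  calc _ ≤ ε / M * (K * M ^ 2 + K * M ^ 2) + (2 * (ε / M))⁻¹ * (2 * ε ^ 2) := by gcongr
    _ = (2 * K + 1) * ε * M := by
        field_simp
        ring
    _ = _ := by
        rw [hε]
        ring
end

section
/- Let ψ: R → R be a measurable, polynomially bounded function (i.e., |ψ(x)| ≤ C(1 + |x|^p) for some C, p > 0) and let τ > 0. Then the function w ↦ E_{z~N(0,1)}[ψ(w + τz)] is differentiable on R, and its derivative equals ∂_w E_{z~N(0,1)}[ψ(w + τz)] = τ^{-1} · E_{z~N(0,1)}[z · ψ(w + τz)]. -/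
set_option autoImplicit false

open MeasureTheory ProbabilityTheory

/-- A polynomially bounded function is bounded by a multiple of `exp |x|`. -/
lemma exists_abs_le_mul_exp_abs_of_abs_le_rpow {ψ : ℝ → ℝ} {C p : ℝ} (hC : 0 ≤ C) (hp : 0 ≤ p)
    (hbound : ∀ x : ℝ, |ψ x| ≤ C * (1 + |x| ^ p)) :
    ∃ K : ℝ, ∀ x : ℝ, |ψ x| ≤ K * Real.exp |x| := by
  obtain ⟨n, hn⟩ := exists_nat_ge p
  refine ⟨C * (1 + n.factorial * Real.exp 1), fun x ↦ (hbound x).trans ?_⟩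
  have hx : 0 ≤ |x| := abs_nonneg x
  have hpow : |x| ^ p ≤ n.factorial * (Real.exp 1 * Real.exp |x|) := calc
    |x| ^ p ≤ (1 + |x|) ^ p := by gcongr; linarith
    _ ≤ (1 + |x|) ^ (n : ℝ) := Real.rpow_le_rpow_of_exponent_le (by linarith) hn
    _ = (1 + |x|) ^ n := Real.rpow_natCast _ _
    _ ≤ n.factorial * Real.exp (1 + |x|) := by
      have := Real.pow_div_factorial_le_exp (1 + |x|) (by linarith) n
      rwa [div_le_iff₀' (by positivity)] at this
    _ = n.factorial * (Real.exp 1 * Real.exp |x|) := by rw [Real.exp_add]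
  have hone : 1 ≤ Real.exp |x| := Real.one_le_exp hx
  calc C * (1 + |x| ^ p)
      ≤ C * (Real.exp |x| + n.factorial * (Real.exp 1 * Real.exp |x|)) := by gcongr
    _ = _ := by ring

lemma integrable_exp_mul_abs_gaussianReal (a : ℝ) :
    Integrable (fun x : ℝ ↦ Real.exp (a * |x|)) (gaussianReal 0 1) :=
  integrable_exp_mul_abs (integrable_exp_mul_gaussianReal a) (integrable_exp_mul_gaussianReal (-a))

/-- The Cameron-Martin formula for the standard Gaussian measure on `ℝ`. -/
lemma integral_comp_add_const_gaussianReal (g : ℝ → ℝ) (h : ℝ) :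
    ∫ z, g (z + h) ∂(gaussianReal 0 1) =
      Real.exp (-h ^ 2 / 2) * ∫ z, Real.exp (h * z) * g z ∂(gaussianReal 0 1) := by
  have hmap := (measurableEmbedding_addRight h).integral_map (μ := gaussianReal 0 1) g
  rw [← hmap, gaussianReal_map_add_const, integral_gaussianReal_eq_integral_smul one_ne_zero,
    integral_gaussianReal_eq_integral_smul one_ne_zero, ← integral_const_mul]
  refine integral_congr_ae (.of_forall fun z ↦ ?_)
  have hexp : Real.exp (-(z - (0 + h)) ^ 2 / (2 * 1)) =
      Real.exp (-h ^ 2 / 2) * Real.exp (h * z) * Real.exp (-(z - 0) ^ 2 / (2 * 1)) := by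
    rw [← Real.exp_add, ← Real.exp_add]
    ring_nf
  simp only [gaussianPDFReal, smul_eq_mul, NNReal.coe_one, hexp]
  ring

/-- Differentiation at `0` of the moment generating function weighted by a function of at most
exponential growth. -/
lemma hasDerivAt_integral_exp_mul_gaussianReal {g : ℝ → ℝ} (hg : Measurable g) {K a : ℝ}
    (hbound : ∀ x, |g x| ≤ K * Real.exp (a * |x|)) :
    HasDerivAt (fun h : ℝ ↦ ∫ z, Real.exp (h * z) * g z ∂(gaussianReal 0 1))
      (∫ z, z * g z ∂(gaussianReal 0 1)) 0 := by
  have key := hasDerivAt_integral_of_dominated_loc_of_deriv_le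
    (μ := gaussianReal 0 1) (𝕜 := ℝ) (x₀ := (0 : ℝ)) (s := Metric.ball 0 1)
    (F := fun h z ↦ Real.exp (h * z) * g z) (F' := fun h z ↦ Real.exp (h * z) * z * g z)
    (bound := fun z ↦ K * Real.exp ((a + 2) * |z|)) (Metric.ball_mem_nhds _ one_pos)
    (.of_forall fun h ↦ by fun_prop) ?_ (by fun_prop) ?_
    ((integrable_exp_mul_abs_gaussianReal _).const_mul K) ?_
  · simpa using key.2
  · refine ((integrable_exp_mul_abs_gaussianReal a).const_mul K).mono' (by fun_prop)
      (.of_forall fun z ↦ ?_)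
    simpa using hbound z
  · refine .of_forall fun z h hh ↦ ?_
    have hh : |h| ≤ 1 := by simpa using (Metric.mem_ball.mp hh).le
    have hexp : Real.exp (h * z) ≤ Real.exp |z| := Real.exp_le_exp.mpr <|
      (le_abs_self _).trans <| by
        rw [abs_mul]
        exact mul_le_of_le_one_left (abs_nonneg z) hh
    have hz : |z| ≤ Real.exp |z| := by linarith [Real.add_one_le_exp |z|]
    calc ‖Real.exp (h * z) * z * g z‖
        = Real.exp (h * z) * |z| * |g z| := by simp
      _ ≤ Real.exp |z| * Real.exp |z| * (K * Real.exp (a * |z|)) := by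
        gcongr
        exact hbound z
      _ = K * Real.exp ((a + 2) * |z|) := by
        rw [show (a + 2) * |z| = |z| + |z| + a * |z| by ring, Real.exp_add, Real.exp_add]
        ring
  · refine .of_forall fun z h _ ↦ ?_
    simpa using (((hasDerivAt_id h).mul_const z).exp).mul_const (g z)

/-- **Gaussian smoothing: derivative in the location parameter.**
For measurable, polynomially bounded `ψ` and `τ > 0`, the map
`w ↦ E_{z ~ N(0,1)}[ψ (w + τ z)]` is differentiable with derivative
`τ⁻¹ E_{z ~ N(0,1)}[z · ψ (w + τ z)]`. -/
theorem hasDerivAt_gaussian_smoothing_location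
    (ψ : ℝ → ℝ) (hmeas : Measurable ψ)
    (C p : ℝ) (hC : 0 < C) (hp : 0 < p)
    (hbound : ∀ x : ℝ, |ψ x| ≤ C * (1 + |x| ^ p))
    (τ : ℝ) (hτ : 0 < τ) (w : ℝ) :
    HasDerivAt (fun u : ℝ => ∫ z : ℝ, ψ (u + τ * z) ∂(gaussianReal 0 1))
      (τ⁻¹ * ∫ z : ℝ, z * ψ (w + τ * z) ∂(gaussianReal 0 1)) w := by
  obtain ⟨K, hK⟩ := exists_abs_le_mul_exp_abs_of_abs_le_rpow hC.le hp.le hbound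
  have hK0 : 0 ≤ K := by simpa using (abs_nonneg _).trans (hK 0)
  have hg : ∀ z, |ψ (w + τ * z)| ≤ K * Real.exp |w| * Real.exp (τ * |z|) := fun z ↦ by
    refine (hK _).trans ?_
    rw [mul_assoc, ← Real.exp_add]
    gcongr
    simpa [abs_mul, abs_of_pos hτ] using abs_add_le w (τ * z)
  have hweighted := hasDerivAt_integral_exp_mul_gaussianReal
    (g := fun z ↦ ψ (w + τ * z)) (by fun_prop) hg
  have hnormal : HasDerivAt (fun h : ℝ ↦ Real.exp (-h ^ 2 / 2)) 0 0 := by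
    simpa using (((hasDerivAt_id (0 : ℝ)).pow 2).neg.div_const 2).exp
  have hshift : HasDerivAt (fun u : ℝ ↦ (u - w) / τ) τ⁻¹ w := by
    simpa using ((hasDerivAt_id w).sub_const w).div_const τ
  have hcomp := (hnormal.mul hweighted).comp_of_eq w hshift (by simp)
  refine (hcomp.congr_of_eventuallyEq (.of_forall fun u ↦ ?_)).congr_deriv (by simp [mul_comm])
  refine Eq.trans ?_ (integral_comp_add_const_gaussianReal (fun z ↦ ψ (w + τ * z)) ((u - w) / τ))
  congr! 3 with z
  field_simp
  ring
end

section
/- Let ψ: R → R be a measurable, polynomially bounded function (i.e., |ψ(x)| ≤ C(1 + |x|^p) for some C, p > 0) and let w ∈ R. Then the function t ↦ E_{z~N(0,1)}[ψ(w + √t · z)] is differentiable on (0, ∞), and its derivative equals ∂_t E_{z~N(0,1)}[ψ(w + √t · z)] = (1/(2t)) · E_{z~N(0,1)}[(z² − 1) · ψ(w + √t · z)]. -/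
set_option autoImplicit false

open MeasureTheory ProbabilityTheory

/-- The density of the centred Gaussian of variance `s`, as a function of `s : ℝ`. -/
noncomputable def heatKernel (s x : ℝ) : ℝ :=
  (Real.sqrt (2 * Real.pi * s))⁻¹ * Real.exp (-x ^ 2 / (2 * s))

lemma integral_comp_sqrt_mul_gaussianReal {h : ℝ → ℝ} (hh : Measurable h) {s : ℝ} (hs : 0 < s) :
    ∫ z, h (Real.sqrt s * z) ∂(gaussianReal 0 1) = ∫ x, heatKernel s x * h x := by
  have hmap : (gaussianReal 0 1).map (fun z => Real.sqrt s * z)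
      = gaussianReal 0 s.toNNReal := by
    rw [gaussianReal_map_const_mul]
    congr 1
    · simp
    · ext
      simp [Real.sq_sqrt hs.le, hs.le]
  have hne : s.toNNReal ≠ 0 := (Real.toNNReal_pos.2 hs).ne'
  rw [← integral_map (f := h) (by fun_prop) hh.aestronglyMeasurable, hmap,
    integral_gaussianReal_eq_integral_smul hne]
  simp [gaussianPDFReal, heatKernel, hs.le]

lemma hasDerivAt_heatKernel {s : ℝ} (hs : 0 < s) (x : ℝ) :
    HasDerivAt (fun s => heatKernel s x) (1 / (2 * s) * (x ^ 2 / s - 1) * heatKernel s x) s := by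
  have hpos : 0 < 2 * Real.pi * s := by positivity
  have h1 : HasDerivAt (fun s : ℝ => 2 * Real.pi * s) (2 * Real.pi) s := by
    simpa using (hasDerivAt_id s).const_mul (2 * Real.pi)
  have h2 := (h1.sqrt hpos.ne').inv (Real.sqrt_pos.2 hpos).ne'
  have h3 : HasDerivAt (fun s : ℝ => -x ^ 2 / (2 * s)) (x ^ 2 / (2 * s ^ 2)) s := by
    have h4 : HasDerivAt (fun s : ℝ => 2 * s) 2 s := by
      simpa using (hasDerivAt_id s).const_mul (2 : ℝ)
    refine ((hasDerivAt_const s (-x ^ 2)).div h4 (by positivity)).congr_deriv ?_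
    field_simp
    ring
  refine (h2.mul h3.exp).congr_deriv ?_
  have hsq := Real.sq_sqrt hpos.le
  have hr := Real.sqrt_pos.2 hpos
  simp only [heatKernel, Pi.inv_apply]
  rw [hsq]
  field_simp
  ring

lemma abs_heatKernel_le {s t : ℝ} (ht : 0 < t) (h1 : t / 2 < s) (h2 : s < 2 * t) (x : ℝ) :
    |heatKernel s x| ≤ (Real.sqrt (Real.pi * t))⁻¹ * Real.exp (-(1 / (4 * t)) * x ^ 2) := by
  have hs : 0 < s := by linarith
  rw [abs_of_nonneg (by unfold heatKernel; positivity), heatKernel]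
  have hpi := Real.pi_pos
  have ha : Real.pi * t ≤ 2 * Real.pi * s := by nlinarith
  have hb : -x ^ 2 / (2 * s) ≤ -(1 / (4 * t)) * x ^ 2 := by
    have : x ^ 2 / (4 * t) ≤ x ^ 2 / (2 * s) :=
      div_le_div_of_nonneg_left (sq_nonneg x) (by positivity) (by linarith)
    calc -x ^ 2 / (2 * s) = -(x ^ 2 / (2 * s)) := by ring
      _ ≤ -(x ^ 2 / (4 * t)) := neg_le_neg this
      _ = _ := by ring
  gcongr

lemma integrable_abs_pow_mul_exp_neg_mul_sq {b : ℝ} (hb : 0 < b) (n : ℕ) :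
    Integrable (fun x : ℝ => |x| ^ n * Real.exp (-b * x ^ 2)) := by
  have h : (-1 : ℝ) < n := by linarith [n.cast_nonneg (α := ℝ)]
  refine (integrable_rpow_mul_exp_neg_mul_sq hb h).norm.congr (.of_forall fun x => ?_)
  simp

lemma exists_abs_comp_const_add_le {ψ : ℝ → ℝ} {C p : ℝ} (hC : 0 < C)
    (hp : 0 < p) (hbound : ∀ x : ℝ, |ψ x| ≤ C * (1 + |x| ^ p)) (w : ℝ) :
    ∃ (A B : ℝ) (n : ℕ), ∀ x, |ψ (w + x)| ≤ A + B * |x| ^ n := by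
  obtain ⟨n, hn⟩ := exists_nat_ge p
  refine ⟨C * (2 + 2 ^ (n - 1) * |w| ^ n), C * 2 ^ (n - 1), n, fun x => ?_⟩
  have hpow : |w + x| ^ p ≤ 1 + |w + x| ^ n := by
    rcases le_total |w + x| 1 with h | h
    · have := Real.rpow_le_one (abs_nonneg _) h hp.le
      have : 0 ≤ |w + x| ^ n := by positivity
      linarith
    · have := Real.rpow_le_rpow_of_exponent_le h hn
      rw [Real.rpow_natCast] at this
      linarith
  have hadd : |w + x| ^ n ≤ 2 ^ (n - 1) * (|w| ^ n + |x| ^ n) :=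
    (pow_le_pow_left₀ (abs_nonneg _) (abs_add_le w x) n).trans
      (add_pow_le (abs_nonneg _) (abs_nonneg _) n)
  calc |ψ (w + x)| ≤ C * (1 + |w + x| ^ p) := hbound _
    _ ≤ C * (1 + (1 + 2 ^ (n - 1) * (|w| ^ n + |x| ^ n))) := by gcongr; linarith
    _ = _ := by ring

lemma hasDerivAt_integral_heatKernel_mul {g : ℝ → ℝ} (hg : Measurable g) {A B : ℝ} {n : ℕ}
    (hle : ∀ x, |g x| ≤ A + B * |x| ^ n) {t : ℝ} (ht : 0 < t) :
    HasDerivAt (fun s => ∫ x, heatKernel s x * g x)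
      (∫ x, 1 / (2 * t) * (x ^ 2 / t - 1) * heatKernel t x * g x) t := by
  have hb : 0 < 1 / (4 * t) := by positivity
  have hK (s : ℝ) : Measurable (heatKernel s) := by unfold heatKernel; fun_prop
  have hint := integrable_abs_pow_mul_exp_neg_mul_sq hb
  set c := (Real.sqrt (Real.pi * t))⁻¹
  have hc : 0 ≤ c := by positivity
  refine (hasDerivAt_integral_of_dominated_loc_of_deriv_le (μ := volume)
    (F := fun s x => heatKernel s x * g x)
    (F' := fun s x => 1 / (2 * s) * (x ^ 2 / s - 1) * heatKernel s x * g x)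
    (s := Set.Ioo (t / 2) (2 * t))
    (bound := fun x => (1 / t * (|x| ^ 2 * (2 / t) + 1))
      * (c * Real.exp (-(1 / (4 * t)) * x ^ 2)) * (A + B * |x| ^ n))
    (Ioo_mem_nhds (by linarith) (by linarith)) ?_ ?_ ?_ ?_ ?_ ?_).2
  · exact .of_forall fun s => ((hK s).mul hg).aestronglyMeasurable
  · refine Integrable.mono' (((hint 0).const_mul (c * A)).add ((hint n).const_mul (c * B)))
      ((hK t).mul hg).aestronglyMeasurable (.of_forall fun x => ?_)
    rw [Real.norm_eq_abs, abs_mul]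
    have h1 := abs_heatKernel_le ht (by linarith) (by linarith : t < 2 * t) x
    calc |heatKernel t x| * |g x|
        ≤ (c * Real.exp (-(1 / (4 * t)) * x ^ 2)) * (A + B * |x| ^ n) := by
          gcongr
          exact hle x
      _ = _ := by simp only [Pi.add_apply]; ring
  · have := hK t
    exact Measurable.aestronglyMeasurable (by fun_prop)
  · refine .of_forall fun x s hs => ?_
    have hs0 : 0 < s := by linarith [hs.1]
    have h1 := abs_heatKernel_le ht hs.1 hs.2 x
    have h2 : |1 / (2 * s)| ≤ 1 / t := by
      rw [abs_of_pos (by positivity)]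
      exact one_div_le_one_div_of_le ht (by linarith [hs.1])
    have h3 : |x ^ 2 / s - 1| ≤ |x| ^ 2 * (2 / t) + 1 := by
      have h4 : x ^ 2 / s ≤ |x| ^ 2 * (2 / t) := by
        rw [sq_abs, div_eq_mul_inv]
        gcongr
        rw [inv_le_comm₀ hs0 (by positivity), inv_div]
        exact hs.1.le
      have h5 : 0 ≤ x ^ 2 / s := by positivity
      rw [abs_le]
      constructor <;> linarith
    rw [Real.norm_eq_abs, abs_mul, abs_mul, abs_mul]
    gcongr
    exact hle x
  · have := ((((hint 0).const_mul (1 / t * c * A)).add ((hint n).const_mul (1 / t * c * B))).add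
      ((hint 2).const_mul (1 / t * c * A * (2 / t)))).add
      ((hint (n + 2)).const_mul (1 / t * c * B * (2 / t)))
    refine this.congr (.of_forall fun x => ?_)
    simp only [Pi.add_apply]
    ring
  · exact .of_forall fun x s hs =>
      (hasDerivAt_heatKernel (by linarith [hs.1]) x).mul_const (g x)

/-- **Gaussian smoothing: derivative in the variance parameter.**
For measurable, polynomially bounded `ψ` and `w ∈ ℝ`, the map
`t ↦ E_{z ~ N(0,1)}[ψ (w + √t · z)]` is differentiable on `(0, ∞)`, with derivative
`(1/(2t)) · E_{z ~ N(0,1)}[(z² − 1) · ψ (w + √t · z)]`. -/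
theorem hasDerivAt_gaussian_smoothing_variance
    (ψ : ℝ → ℝ) (hmeas : Measurable ψ)
    (C p : ℝ) (hC : 0 < C) (hp : 0 < p)
    (hbound : ∀ x : ℝ, |ψ x| ≤ C * (1 + |x| ^ p))
    (w : ℝ) (t : ℝ) (ht : 0 < t) :
    HasDerivAt (fun s : ℝ => ∫ z : ℝ, ψ (w + Real.sqrt s * z) ∂(gaussianReal 0 1))
      ((1 / (2 * t)) * ∫ z : ℝ, (z ^ 2 - 1) * ψ (w + Real.sqrt t * z) ∂(gaussianReal 0 1))
      t := by
  obtain ⟨A, B, n, hle⟩ := exists_abs_comp_const_add_le hC hp hbound w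
  have hg : Measurable fun x => ψ (w + x) := by fun_prop
  have hderiv : (1 / (2 * t)) *
      ∫ z : ℝ, (z ^ 2 - 1) * ψ (w + Real.sqrt t * z) ∂(gaussianReal 0 1)
      = ∫ x, 1 / (2 * t) * (x ^ 2 / t - 1) * heatKernel t x * ψ (w + x) := by
    have h := integral_comp_sqrt_mul_gaussianReal
      (h := fun x => (x ^ 2 / t - 1) * ψ (w + x)) (by fun_prop) ht
    simp only [mul_pow, Real.sq_sqrt ht.le, mul_div_cancel_left₀ _ ht.ne'] at h
    rw [h, ← integral_const_mul]
    congr 1 with x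
    ring
  rw [hderiv]
  refine (hasDerivAt_integral_heatKernel_mul hg hle ht).congr_of_eventuallyEq ?_
  filter_upwards [Ioi_mem_nhds ht] with s hs
  exact integral_comp_sqrt_mul_gaussianReal hg hs
end

section
/- Let (A_n)_{n≥1} be a sequence of real k×l matrices converging (entrywise) to a matrix A, and suppose rank(A_n) = rank(A) for all n. For each n let A_n⁺ be the Moore–Penrose pseudoinverse of A_n and let A⁺ be the Moore–Penrose pseudoinverse of A. Then A_n⁺ → A⁺ entrywise as n → ∞. -/
set_option autoImplicit false

open Matrix Filter

namespace Matrix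

/-- If left multiplication by `G` preserves the rank of `B`, it loses no information on the
range of `B`. -/
theorem mul_eq_zero_of_rank_mul_eq {K m n p q : Type*} [Field K] [Fintype m] [Fintype n]
    [Fintype p] [Fintype q] [DecidableEq q] {G : Matrix p m K} {B : Matrix m n K}
    (h : (G * B).rank = B.rank) {C : Matrix n q K} (hC : G * B * C = 0) : B * C = 0 := by
  have hle : B.mulVecLin.ker ≤ (G * B).mulVecLin.ker := by
    intro v hv
    simp only [LinearMap.mem_ker, mulVecLin_apply] at hv ⊢
    rw [← mulVec_mulVec, hv, mulVec_zero]
  have hker : B.mulVecLin.ker = (G * B).mulVecLin.ker := by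
    apply Submodule.eq_of_le_of_finrank_eq hle
    have h₁ := B.mulVecLin.finrank_range_add_finrank_ker
    have h₂ := (G * B).mulVecLin.finrank_range_add_finrank_ker
    unfold rank at h
    omega
  apply ext_of_mulVec_single
  intro j
  have hv : C *ᵥ Pi.single j 1 ∈ (G * B).mulVecLin.ker := by
    simp only [LinearMap.mem_ker, mulVecLin_apply, mulVec_mulVec, hC, zero_mulVec]
  rw [← hker, LinearMap.mem_ker, mulVecLin_apply, mulVec_mulVec] at hv
  rw [hv, zero_mulVec]

/-- If `G` is a reflexive generalized inverse of `A`, and `B` has the rank of `A`, then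
`(1 - G * A + G * B)⁻¹ * G` is a generalized inverse of `B` as soon as the inverse exists. -/
theorem mul_inv_mul_mul_self_of_rank_eq {K m n : Type*} [Field K] [Fintype m] [Fintype n]
    [DecidableEq n] {A B : Matrix m n K} {G : Matrix n m K}
    (hA : A * G * A = A) (hG : G * A * G = G) (hrank : B.rank = A.rank)
    (hU : IsUnit (1 - G * A + G * B).det) :
    B * ((1 - G * A + G * B)⁻¹ * G) * B = B := by
  set U := 1 - G * A + G * B with hU_def
  have hGAU : G * A * U = G * B := by
    rw [hU_def]
    simp only [mul_add, mul_sub, mul_one, ← Matrix.mul_assoc, hG]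
    abel
  have hGA : (G * A).rank = A.rank := by
    apply le_antisymm (rank_mul_le_right G A)
    calc A.rank = (A * (G * A)).rank := by rw [← Matrix.mul_assoc, hA]
      _ ≤ (G * A).rank := rank_mul_le_right _ _
  have hGB : (G * B).rank = B.rank := by
    rw [← hGAU, rank_mul_eq_left_of_isUnit_det _ _ hU, hGA, hrank]
  have hGBU : G * B * U⁻¹ = G * A := by
    rw [← hGAU, mul_nonsing_inv_cancel_right _ _ hU]
  have hC : G * B * (U⁻¹ * (G * B) - 1) = 0 := by
    rw [mul_sub, ← Matrix.mul_assoc, hGBU, ← Matrix.mul_assoc, hG, mul_one, sub_self]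
  have := mul_eq_zero_of_rank_mul_eq hGB hC
  rw [Matrix.mul_sub, Matrix.mul_one, sub_eq_zero] at this
  simpa only [Matrix.mul_assoc] using this

theorem tendsto_matrix_mul {α m n p R : Type*} [Fintype n] [NonUnitalNonAssocSemiring R]
    [TopologicalSpace R] [ContinuousAdd R] [ContinuousMul R] {f : Filter α}
    {B : α → Matrix m n R} {C : α → Matrix n p R} {B' : Matrix m n R} {C' : Matrix n p R}
    (hB : Tendsto B f (nhds B')) (hC : Tendsto C f (nhds C')) :
    Tendsto (fun a => B a * C a) f (nhds (B' * C')) :=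
  ((continuous_fst.matrix_mul continuous_snd).tendsto (B', C')).comp (hB.prodMk_nhds hC)

theorem tendsto_inv {α n K : Type*} [Fintype n] [DecidableEq n] [NormedField K]
    {f : Filter α} {U : α → Matrix n n K} {V : Matrix n n K} (hV : V.det ≠ 0)
    (h : Tendsto U f (nhds V)) : Tendsto (fun a => (U a)⁻¹) f (nhds V⁻¹) := by
  refine (continuousAt_matrix_inv V ?_).tendsto.comp h
  rw [Ring.inverse_eq_inv']
  exact continuousAt_inv₀ hV

/-- The orthogonal projection `B * P` onto the range of `B`, in terms of any generalized
inverse `X` of `B`. -/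
theorem mul_mul_add_transpose_sub_one {R m n : Type*} [CommRing R] [Fintype m] [Fintype n]
    [DecidableEq m] {B : Matrix m n R} {P X : Matrix n m R} (hP : B * P * B = B)
    (hPt : (B * P)ᵀ = B * P) (hX : B * X * B = B) :
    B * P * (B * X + (B * X)ᵀ - 1) = B * X := by
  have h₁ : B * P * (B * X) = B * X := by rw [← Matrix.mul_assoc, hP]
  have h₂ : B * P * (B * X)ᵀ = B * P := by
    conv_lhs => rw [← hPt]
    rw [← transpose_mul, ← Matrix.mul_assoc, hX, hPt]
  rw [mul_sub, mul_add, h₁, h₂, mul_one, add_sub_cancel_right]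

theorem tendsto_mul_of_generalized_inverse {α m n : Type*} [Fintype m] [Fintype n]
    [DecidableEq m] {f : Filter α} {B : α → Matrix m n ℝ} {A : Matrix m n ℝ}
    {P X : α → Matrix n m ℝ} {G : Matrix n m ℝ}
    (hB : Tendsto B f (nhds A)) (hX : Tendsto X f (nhds G))
    (hP : ∀ a, B a * P a * B a = B a) (hPt : ∀ a, (B a * P a)ᵀ = B a * P a)
    (hBX : ∀ᶠ a in f, B a * X a * B a = B a)
    (hG : A * G * A = A) (hGt : (A * G)ᵀ = A * G) :
    Tendsto (fun a => B a * P a) f (nhds (A * G)) := by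
  let S : Matrix m m ℝ → Matrix m m ℝ := fun R => R + Rᵀ - 1
  have hS : Continuous S := by fun_prop
  have hR : Tendsto (fun a => B a * X a) f (nhds (A * G)) :=
    tendsto_matrix_mul hB hX
  have hSR : Tendsto (fun a => S (B a * X a)) f (nhds (S (A * G))) := (hS.tendsto _).comp hR
  have hsq : S (A * G) * S (A * G) = 1 := by
    have hidem : A * G * (A * G) = A * G := by rw [← Matrix.mul_assoc, hG]
    simp only [S, hGt, mul_sub, sub_mul, mul_add, add_mul, hidem, mul_one, one_mul]
    abel
  have hdet : (S (A * G)).det ≠ 0 := (isUnit_det_of_left_inverse hsq).ne_zero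
  have hlim := tendsto_matrix_mul hR (tendsto_inv hdet hSR)
  have hAG : A * G * (S (A * G))⁻¹ = A * G := by
    have h := congr_arg (· * (S (A * G))⁻¹) (mul_mul_add_transpose_sub_one hG hGt hG)
    exact h.symm.trans (mul_nonsing_inv_cancel_right _ _ hdet.isUnit)
  rw [hAG] at hlim
  refine hlim.congr' ?_
  filter_upwards [hBX, (continuous_id.matrix_det.tendsto _).comp hSR |>.eventually_ne hdet]
    with a ha hdet_a
  have h := congr_arg (· * (S (B a * X a))⁻¹) (mul_mul_add_transpose_sub_one (hP a) (hPt a) ha)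
  exact h.symm.trans (mul_nonsing_inv_cancel_right _ _ (IsUnit.mk0 _ hdet_a))

end Matrix

/-- **Continuity of the Moore–Penrose pseudoinverse at constant rank.**
If `A n → A` entrywise, `rank (A n) = rank A` for all `n`, and `Ap n` (resp. `Ap`) is the
Moore–Penrose pseudoinverse of `A n` (resp. `A`), then `Ap n → Ap` entrywise. -/
theorem pseudoinverse_tendsto_of_rank_eq
    (k l : ℕ) (A : ℕ → Matrix (Fin k) (Fin l) ℝ) (Alim : Matrix (Fin k) (Fin l) ℝ)
    (Ap : ℕ → Matrix (Fin l) (Fin k) ℝ) (Aplim : Matrix (Fin l) (Fin k) ℝ)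
    (hconv : ∀ i j, Tendsto (fun n => A n i j) atTop (nhds (Alim i j)))
    (hrank : ∀ n, (A n).rank = Alim.rank)
    (hMP1 : ∀ n, A n * Ap n * A n = A n)
    (hMP2 : ∀ n, Ap n * A n * Ap n = Ap n)
    (hMP3 : ∀ n, (A n * Ap n)ᵀ = A n * Ap n)
    (hMP4 : ∀ n, (Ap n * A n)ᵀ = Ap n * A n)
    (hMP1' : Alim * Aplim * Alim = Alim)
    (hMP2' : Aplim * Alim * Aplim = Aplim)
    (hMP3' : (Alim * Aplim)ᵀ = Alim * Aplim)
    (hMP4' : (Aplim * Alim)ᵀ = Aplim * Alim) :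
    ∀ i j, Tendsto (fun n => Ap n i j) atTop (nhds (Aplim i j)) := by
  have hA : Tendsto A atTop (nhds Alim) :=
    tendsto_pi_nhds.2 fun i => tendsto_pi_nhds.2 fun j => hconv i j
  have hU : Tendsto (fun n => 1 - Aplim * Alim + Aplim * A n) atTop (nhds 1) := by
    have hcont : Continuous fun M : Matrix (Fin k) (Fin l) ℝ =>
        1 - Aplim * Alim + Aplim * M := by fun_prop
    simpa [Function.comp_def] using (hcont.tendsto Alim).comp hA
  have hdet : (1 : Matrix (Fin l) (Fin l) ℝ).det ≠ 0 := by simp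
  obtain ⟨X, hX, hAX⟩ : ∃ X : ℕ → Matrix (Fin l) (Fin k) ℝ,
      Tendsto X atTop (nhds Aplim) ∧ ∀ᶠ n in atTop, A n * X n * A n = A n := by
    refine ⟨fun n => (1 - Aplim * Alim + Aplim * A n)⁻¹ * Aplim, ?_, ?_⟩
    · simpa using tendsto_matrix_mul (tendsto_inv hdet hU) (tendsto_const_nhds (x := Aplim))
    · filter_upwards [(continuous_id.matrix_det.tendsto _).comp hU |>.eventually_ne hdet]
        with n hn
      exact mul_inv_mul_mul_self_of_rank_eq hMP1' hMP2' (hrank n) (IsUnit.mk0 _ hn)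
  have hleft : Tendsto (fun n => A n * Ap n) atTop (nhds (Alim * Aplim)) :=
    tendsto_mul_of_generalized_inverse hA hX hMP1 hMP3 hAX hMP1' hMP3'
  have htranspose {B : Matrix (Fin k) (Fin l) ℝ} {Y : Matrix (Fin l) (Fin k) ℝ}
      (h : B * Y * B = B) : Bᵀ * Yᵀ * Bᵀ = Bᵀ := by
    rw [Matrix.mul_assoc, ← transpose_mul, ← transpose_mul, h]
  have hright : Tendsto (fun n => Ap n * A n) atTop (nhds (Aplim * Alim)) := by
    have h := tendsto_mul_of_generalized_inverse
      (B := fun n => (A n)ᵀ) (P := fun n => (Ap n)ᵀ) (X := fun n => (X n)ᵀ)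
      ((continuous_id.matrix_transpose.tendsto _).comp hA)
      ((continuous_id.matrix_transpose.tendsto _).comp hX)
      (fun n => htranspose (hMP1 n))
      (fun n => by rw [← transpose_mul, hMP4, hMP4])
      (hAX.mono fun n hn => htranspose hn)
      (htranspose hMP1')
      (by simp only [id, ← transpose_mul, hMP4'])
    simpa only [id, ← transpose_mul, hMP4, hMP4'] using h
  have hAp : Tendsto Ap atTop (nhds Aplim) := by
    have h := tendsto_matrix_mul (tendsto_matrix_mul hright hX) hleft
    rw [hMP2', ← Matrix.mul_assoc, hMP2'] at h
    refine h.congr' (hAX.mono fun n hn => ?_)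
    calc Ap n * A n * X n * (A n * Ap n) = Ap n * (A n * X n * A n) * Ap n := by
          simp only [Matrix.mul_assoc]
      _ = Ap n := by rw [hn, hMP2]
  exact fun i j => tendsto_pi_nhds.1 (tendsto_pi_nhds.1 hAp i) j
end
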